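/- arXiv:1312.7630 — 2 statements merged into one kernel-verified Lean document; each statement's English description precedes it below -/
import Mathlib

section
/- Fix d ≥ 1 and vectors λ_1, ..., λ_{n-1} ∈ ℝ^d, where λ_j represents the log action-likelihood contributed by node j. Suppose each node m ∈ {1, ..., n−1} holds the log-belief l_m = Σ_{j : T_n(j, m) = 1} λ_j (the sum of the contributions of all nodes with a path to m, including m itself). Then the weighted combination with weights w_n = T_{n-1}^{-1} t_n recovers the fair (incest-free) rating based on all information reaching node n: Σ_{m=1}^{n-1} w_n(m) l_m = Σ_{m ∈ F_n} λ_m. -/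
open Matrix
open scoped Classical

/-- The inverse of a unit upper triangular matrix has ones on its diagonal. -/
theorem Matrix.inv_diag_eq_one_of_unit_upperTriangular {m R : Type*} [Fintype m] [LinearOrder m]
    [CommRing R] {M : Matrix m m R} (hM : M.BlockTriangular id) (hdiag : ∀ i, M i i = 1) (i : m) :
    M⁻¹ i i = 1 := by
  have hdet : IsUnit M.det := by simp [Matrix.det_of_isUpperTriangular hM, hdiag]
  let _ := M.invertibleOfIsUnitDet hdet
  have hinv := Matrix.blockTriangular_inv_of_blockTriangular hM
  have h := congrFun (congrFun (M.mul_nonsing_inv hdet) i) i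
  rw [Matrix.mul_apply, Finset.sum_eq_single i, hdiag, one_mul, Matrix.one_apply_eq] at h
  · exact h
  · intro k _ hk
    rcases lt_or_gt_of_ne hk with hlt | hgt
    · rw [hM hlt, zero_mul]
    · rw [hinv hgt, mul_zero]
  · simp

/-- Fair Rating Algorithm: Consider a DAG on nodes `{0, ..., n}` (edges go
from smaller to larger indices; the last node `n` plays the role of node "n" of the paper,
the previous nodes are `0, ..., n-1`), with 0-1 strictly upper triangular adjacency matrix
`A` and transitive closure matrix `T = sgn((I − A)⁻¹)`.  Fix `d ≥ 1` and log
action-likelihood vectors `lam 0, ..., lam (n-1) ∈ ℝ^d`, and suppose every previous node `m`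
holds the log-belief `l m = ∑_{j : T(j,m) = 1} lam j` (sum over all nodes with a path to `m`,
including `m` itself).  Then the weighted combination with weights `w = T_{n-1}⁻¹ t_n`
recovers the fair (incest-free) rating based on all information reaching node `n`:
`∑_m w m • l m = ∑_{m ∈ F_n} lam m`, where `F_n = {m : T(m,n) = 1}`. -/
theorem fair_rating_algorithm
    (n d : ℕ) (hd : 1 ≤ d)
    (A : Matrix (Fin (n+1)) (Fin (n+1)) ℝ)
    (hA01 : ∀ i j, A i j = 0 ∨ A i j = 1)
    (hAtri : ∀ i j : Fin (n+1), j ≤ i → A i j = 0)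
    (T : Matrix (Fin (n+1)) (Fin (n+1)) ℝ)
    (hT : ∀ i j, T i j = if (1 - A)⁻¹ i j ≠ 0 then (1:ℝ) else 0)
    (w : Fin n → ℝ)
    (hw : w = (T.submatrix Fin.castSucc Fin.castSucc)⁻¹ *ᵥ
        (fun m : Fin n => T m.castSucc (Fin.last n)))
    (lam : Fin n → Fin d → ℝ)
    (l : Fin n → Fin d → ℝ)
    (hl : ∀ m : Fin n,
      l m = ∑ j ∈ Finset.univ.filter (fun j : Fin n => T j.castSucc m.castSucc = 1), lam j) :
    ∑ m : Fin n, w m • l m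
      = ∑ m ∈ Finset.univ.filter (fun m : Fin n => T m.castSucc (Fin.last n) = 1), lam m := by
  have hM : (1 - A).BlockTriangular id := fun i j hij => by
    have hij' : j < i := hij
    simp [Matrix.one_apply_ne hij'.ne', hAtri i j hij'.le]
  have hdiag : ∀ i, (1 - A) i i = 1 := fun i => by simp [hAtri i i le_rfl]
  have hdet : IsUnit (1 - A).det := by simp [Matrix.det_of_isUpperTriangular hM, hdiag]
  let _ := (1 - A).invertibleOfIsUnitDet hdet
  have hinv := Matrix.blockTriangular_inv_of_blockTriangular hM
  set S : Matrix (Fin n) (Fin n) ℝ := T.submatrix Fin.castSucc Fin.castSucc with hS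
  have hSdet : IsUnit S.det := by
    have hStri : S.BlockTriangular id := fun i j hij => by
      have h : (1 - A)⁻¹ i.castSucc j.castSucc = 0 := hinv (Fin.castSucc_lt_castSucc_iff.2 hij)
      simp [hS, hT, h]
    have hSdiag : ∀ i, S i i = 1 := fun i => by
      simp [hS, hT, Matrix.inv_diag_eq_one_of_unit_upperTriangular hM hdiag]
    simp [Matrix.det_of_isUpperTriangular hStri, hSdiag]
  have hSw : S *ᵥ w = fun m : Fin n => T m.castSucc (Fin.last n) := by
    rw [hw, Matrix.mulVec_mulVec, Matrix.mul_nonsing_inv _ hSdet, Matrix.one_mulVec]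
  have hsum : ∀ k, ∑ j ∈ Finset.univ.filter (fun j : Fin n => T j.castSucc k = 1), lam j
      = ∑ j, T j.castSucc k • lam j := fun k => by
    rw [Finset.sum_filter]
    refine Finset.sum_congr rfl fun j _ => ?_
    rw [hT]
    split_ifs <;> simp_all
  rw [hsum]
  simp_rw [hl, hsum, Finset.smul_sum]
  rw [Finset.sum_comm]
  refine Finset.sum_congr rfl fun j _ => ?_
  rw [← congrFun hSw j, Matrix.mulVec, dotProduct, Finset.sum_smul]
  refine Finset.sum_congr rfl fun m _ => ?_
  rw [smul_smul, mul_comm, hS, Matrix.submatrix_apply]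
end

section
/- There exists a function g : (ℝ^d)^{H_n} → ℝ^d such that g((l_m)_{m ∈ H_n}) = Σ_{m ∈ F_n} λ_m for every choice of λ_1, ..., λ_{n-1} ∈ ℝ^d (where l_m = Σ_{j : T_n(j, m) = 1} λ_j) if and only if w_n(j) = 0 for every j < n with A_n(j, n) = 0. That is, the fair rating at node n is computable from the single-hop information available to node n, for all possible action log-likelihoods, exactly when the weight vector w_n is supported on the single-hop predecessors H_n. -/
open Matrix
open scoped Classical

theorem Matrix.BlockTriangular.apply_self_ne_zero {ι K : Type*} [Fintype ι] [LinearOrder ι]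
    [Field K] {M : Matrix ι ι K} (hM : M.BlockTriangular id) (hdet : M.det ≠ 0) (i : ι) :
    M i i ≠ 0 := by
  rw [Matrix.det_of_isUpperTriangular hM] at hdet
  exact Finset.prod_ne_zero_iff.mp hdet i (Finset.mem_univ i)

/-- The sign pattern of the inverse of an invertible upper triangular matrix has determinant one
on every leading principal submatrix. -/
theorem Matrix.det_submatrix_sign_inv_eq_one {n : ℕ}
    {M T : Matrix (Fin (n + 1)) (Fin (n + 1)) ℝ}
    (hM : M.BlockTriangular id) (hdet : M.det ≠ 0)
    (hT : ∀ i j, T i j = if M⁻¹ i j ≠ 0 then (1 : ℝ) else 0) :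
    (T.submatrix Fin.castSucc Fin.castSucc).det = 1 := by
  have := M.invertibleOfIsUnitDet (isUnit_iff_ne_zero.mpr hdet)
  have hinv : M⁻¹.BlockTriangular id := Matrix.blockTriangular_inv_of_blockTriangular hM
  have hinvdet : M⁻¹.det ≠ 0 := by
    rw [Matrix.det_nonsing_inv, Ring.inverse_eq_inv']
    exact inv_ne_zero hdet
  rw [Matrix.det_of_isUpperTriangular]
  · refine Finset.prod_eq_one fun i _ => ?_
    rw [Matrix.submatrix_apply, hT, if_pos (hinv.apply_self_ne_zero hinvdet _)]
  · intro i j hij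
    have h : M⁻¹ i.castSucc j.castSucc = 0 := hinv (Fin.castSucc_lt_castSucc_iff.mpr hij)
    rw [Matrix.submatrix_apply, hT, if_neg (not_not.mpr h)]

/-- A sum over the support of a `0`-`1` vector is a weighted sum. -/
theorem sum_filter_eq_one_eq_sum_smul {ι E : Type*} [Fintype ι] [AddCommGroup E] [Module ℝ E]
    {v : ι → ℝ} (hv : ∀ i, v i = 0 ∨ v i = 1) (f : ι → E) :
    ∑ i ∈ Finset.univ.filter (fun i => v i = 1), f i = ∑ i, v i • f i := by
  rw [Finset.sum_filter]
  refine Finset.sum_congr rfl fun i _ => ?_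
  rcases hv i with h | h <;> simp [h]

/-- Achievability of the Fair Rating: With the DAG, transitive closure `T` and
weight vector `w = T_{n-1}⁻¹ t_n` as in the fair rating algorithm (nodes `{0, ..., n}`, node
`n` last), the fair rating `∑_{m ∈ F_n} lam m` at node `n` is computable by some function `g`
from the single-hop information `(l m)_{m ∈ H_n}` available to node `n` — where
`l m = ∑_{j : T(j,m) = 1} lam j` and `H_n = {m : A(m,n) = 1}` — simultaneously for all
possible log action-likelihoods `lam`, if and only if the weight vector `w` vanishes outside
`H_n`, i.e. `A(j,n) = 0 → w j = 0`. -/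
theorem fair_rating_achievable_iff_weights_single_hop
    (n d : ℕ) (hd : 1 ≤ d)
    (A : Matrix (Fin (n+1)) (Fin (n+1)) ℝ)
    (hA01 : ∀ i j, A i j = 0 ∨ A i j = 1)
    (hAtri : ∀ i j : Fin (n+1), j ≤ i → A i j = 0)
    (T : Matrix (Fin (n+1)) (Fin (n+1)) ℝ)
    (hT : ∀ i j, T i j = if (1 - A)⁻¹ i j ≠ 0 then (1:ℝ) else 0)
    (w : Fin n → ℝ)
    (hw : w = (T.submatrix Fin.castSucc Fin.castSucc)⁻¹ *ᵥ
        (fun m : Fin n => T m.castSucc (Fin.last n))) :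
    (∃ g : ({m : Fin n // A m.castSucc (Fin.last n) = 1} → (Fin d → ℝ)) → (Fin d → ℝ),
        ∀ lam : Fin n → Fin d → ℝ,
          g (fun m => ∑ j ∈ Finset.univ.filter
                (fun j : Fin n => T j.castSucc m.val.castSucc = 1), lam j)
            = ∑ m ∈ Finset.univ.filter
                (fun m : Fin n => T m.castSucc (Fin.last n) = 1), lam m)
    ↔ (∀ j : Fin n, A j.castSucc (Fin.last n) = 0 → w j = 0) := by
  have hM : (1 - A).BlockTriangular id := by
    intro i j hij
    have hij' : j < i := hij
    simp [hAtri i j hij'.le, Matrix.one_apply_ne hij'.ne']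
  have hMdet : (1 - A).det ≠ 0 := by
    rw [Matrix.det_of_isUpperTriangular hM]
    simp [hAtri _ _ le_rfl]
  have hT01 : ∀ i j, T i j = 0 ∨ T i j = 1 := by
    intro i j
    rw [hT]
    split_ifs <;> simp
  have hdet := Matrix.det_submatrix_sign_inv_eq_one hM hMdet hT
  set B := T.submatrix Fin.castSucc Fin.castSucc with hB
  set t : Fin n → ℝ := fun m => T m.castSucc (Fin.last n) with ht
  have hunit : IsUnit B.det := by simp [hdet]
  have hBw : B *ᵥ w = t := by
    rw [hw, Matrix.mulVec_mulVec, Matrix.mul_nonsing_inv _ hunit, Matrix.one_mulVec]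
  have hl : ∀ (lam : Fin n → Fin d → ℝ) (m : Fin n),
      ∑ j ∈ Finset.univ.filter (fun j : Fin n => T j.castSucc m.castSucc = 1), lam j
        = ∑ j, B j m • lam j := fun lam m =>
    sum_filter_eq_one_eq_sum_smul (v := fun j => T j.castSucc m.castSucc)
      (fun _ => hT01 _ _) lam
  have hr : ∀ lam : Fin n → Fin d → ℝ,
      ∑ m ∈ Finset.univ.filter (fun m : Fin n => T m.castSucc (Fin.last n) = 1), lam m
        = ∑ m, t m • lam m := fun lam =>
    sum_filter_eq_one_eq_sum_smul (v := t) (fun _ => hT01 _ _) lam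
  simp only [hl, hr]
  constructor
  · rintro ⟨g, hg⟩ j hj
    have h0 := hg 0
    have h1 := hg fun m _ => B⁻¹ j m
    have hzero : (fun m : {m : Fin n // A m.castSucc (Fin.last n) = 1} =>
        ∑ i, B i m.val • (fun _ : Fin d => B⁻¹ j i)) = 0 := by
      funext m k
      have hne : j ≠ m.val := by
        rintro rfl
        exact zero_ne_one (hj.symm.trans m.property)
      have h := congrFun (congrFun (Matrix.nonsing_inv_mul B hunit) j) m.val
      rw [Matrix.mul_apply, Matrix.one_apply_ne hne] at h
      simpa [Finset.sum_apply, mul_comm] using h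
    rw [hzero] at h1
    have hg0 : g 0 = 0 := by
      simp only [Pi.zero_apply, smul_zero, Finset.sum_const_zero] at h0
      exact h0
    rw [hg0] at h1
    have h2 := congrFun h1 ⟨0, hd⟩
    rw [hw]
    simpa [Matrix.mulVec, dotProduct, Finset.sum_apply, mul_comm] using h2.symm
  · intro h
    refine ⟨fun x => ∑ m, w m.val • x m, fun lam => ?_⟩
    have hsub : ∀ f : Fin n → Fin d → ℝ,
        ∑ m : {m : Fin n // A m.castSucc (Fin.last n) = 1}, w m.val • f m.val
          = ∑ m, w m • f m := by
      intro f
      rw [← Finset.sum_subtype (Finset.univ.filter fun m : Fin n =>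
        A m.castSucc (Fin.last n) = 1) (by simp) fun m => w m • f m]
      refine Finset.sum_subset (Finset.subset_univ _) fun m _ hm => ?_
      have hA : A m.castSucc (Fin.last n) = 0 :=
        (hA01 _ _).resolve_right (by simpa using hm)
      rw [h m hA, zero_smul]
    refine (hsub fun m => ∑ j, B j m • lam j).trans ?_
    rw [← hBw]
    simp only [Finset.smul_sum, Matrix.mulVec, dotProduct, Finset.sum_smul, smul_smul]
    rw [Finset.sum_comm]
    simp only [mul_comm]
end
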